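/- With the fixed-pair setup in a diregular (2,k,+3)-digraph with k ≥ 3: either v₁ ∈ O(u) or u₁ ∈ O(v). -/

import Mathlib

/-- `p` is a directed walk from `u` to `v` in the digraph with arc relation `A`,
recorded as the list of its vertices; a walk of length `l` (i.e. with `l` arcs)
is a list of `l + 1` vertices. -/
def IsWalkFrom {V : Type*} (A : V → V → Prop) (u v : V) (p : List V) : Prop :=
  p.Chain' A ∧ p.head? = some u ∧ p.getLast? = some v

/-- A digraph is `k`-geodetic if for every ordered pair of vertices `(u, v)`
there is at most one directed path of length at most `k` from `u` to `v`. -/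
def IsKGeodetic {V : Type*} (A : V → V → Prop) (k : ℕ) : Prop :=
  ∀ (u v : V) (p q : List V), IsWalkFrom A u v p → IsWalkFrom A u v q →
    p.length ≤ k + 1 → q.length ≤ k + 1 → p = q

/-- `Nout A u = N⁺(u)`, the set of out-neighbours of `u`. -/
def Nout {V : Type*} (A : V → V → Prop) (u : V) : Set V := {v | A u v}

/-- `Nin A u = N⁻(u)`, the set of in-neighbours of `u`. -/
def Nin {V : Type*} (A : V → V → Prop) (u : V) : Set V := {v | A v u}

/-- `NIter A l u = N^l(u)`, the set of vertices reachable from `u` by a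
directed path of length exactly `l`. -/
def NIter {V : Type*} (A : V → V → Prop) (l : ℕ) (u : V) : Set V :=
  {v | ∃ p : List V, IsWalkFrom A u v p ∧ p.length = l + 1}

/-- `Ball A l u = T_l(u) = N^0(u) ∪ N^1(u) ∪ ⋯ ∪ N^l(u)`, the set of vertices
at distance at most `l` from `u`. -/
def Ball {V : Type*} (A : V → V → Prop) (l : ℕ) (u : V) : Set V :=
  {v | ∃ m ≤ l, v ∈ NIter A m u}

/-- `Outliers A k u = O(u) = {v | d(u,v) ≥ k + 1}`, the outlier set of `u`. -/
def Outliers {V : Type*} (A : V → V → Prop) (k : ℕ) (u : V) : Set V :=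
  {v | v ∉ Ball A k u}

/-- A digraph is diregular with degree `d` if every vertex has out-degree `d`
and in-degree `d`. -/
def IsDiregular {V : Type*} (A : V → V → Prop) (d : ℕ) : Prop :=
  ∀ u : V, (Nout A u).ncard = d ∧ (Nin A u).ncard = d

/-- The Moore bound `M(d,k) = 1 + d + d² + ⋯ + d^k`. -/
def moore (d k : ℕ) : ℕ := ∑ i ∈ Finset.range (k + 1), d ^ i

section Walks

variable {V : Type*} {A : V → V → Prop}

lemma IsWalkFrom.cons {x z y : V} {p : List V} (h : A x z) (hp : IsWalkFrom A z y p) :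
    IsWalkFrom A x y (x :: p) := by
  obtain ⟨hc, hh, hl⟩ := hp
  cases p with
  | nil => simp at hh
  | cons w p =>
    obtain rfl : w = z := by simpa using hh
    exact ⟨List.isChain_cons_cons.2 ⟨h, hc⟩, rfl, by simpa using hl⟩

lemma mem_nIter_zero {x y : V} : y ∈ NIter A 0 x ↔ x = y := by
  constructor
  · rintro ⟨p, ⟨-, hh, hl⟩, hp⟩
    obtain ⟨w, rfl⟩ := List.length_eq_one_iff.1 hp
    exact (Option.some.inj hh).symm.trans (Option.some.inj hl)
  · rintro rfl
    exact ⟨[x], ⟨List.isChain_singleton x, rfl, rfl⟩, rfl⟩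

lemma mem_nIter_succ {n : ℕ} {x y : V} :
    y ∈ NIter A (n + 1) x ↔ ∃ z, A x z ∧ y ∈ NIter A n z := by
  constructor
  · rintro ⟨p, ⟨hc, hh, hl⟩, hp⟩
    match p, hp with
    | w :: z :: p, hp =>
      obtain rfl : w = x := by simpa using hh
      obtain ⟨hwz, hc⟩ := List.isChain_cons_cons.1 hc
      exact ⟨z, hwz, z :: p, ⟨hc, rfl, by simpa using hl⟩, by simpa using hp⟩
  · rintro ⟨z, hz, p, hp, hlen⟩
    exact ⟨x :: p, hp.cons hz, by simp [hlen]⟩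

lemma mem_nIter_one {x y : V} : y ∈ NIter A 1 x ↔ A x y := by
  simp [mem_nIter_succ, mem_nIter_zero]

lemma mem_nIter_add {m n : ℕ} {x y z : V} (h : y ∈ NIter A m x) (h' : z ∈ NIter A n y) :
    z ∈ NIter A (m + n) x := by
  induction m generalizing x with
  | zero =>
    obtain rfl := mem_nIter_zero.1 h
    simpa using h'
  | succ m ih =>
    obtain ⟨w, hw, h⟩ := mem_nIter_succ.1 h
    rw [Nat.add_right_comm]
    exact mem_nIter_succ.2 ⟨w, hw, ih h⟩

/-- A vertex within distance `k` of `x` is `x` itself or within distance `k - 1` of an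
out-neighbour of `x`. -/
lemma eq_or_mem_nIter_of_mem_ball {k : ℕ} {x y a b : V} (hx : Nout A x = {a, b})
    (h : y ∈ Ball A k x) :
    y = x ∨ (∃ m < k, y ∈ NIter A m a) ∨ ∃ m < k, y ∈ NIter A m b := by
  obtain ⟨m, hm, h⟩ := h
  cases m with
  | zero => exact .inl (mem_nIter_zero.1 h).symm
  | succ m =>
    obtain ⟨z, hz, h⟩ := mem_nIter_succ.1 h
    have hz : z ∈ Nout A x := hz
    rw [hx] at hz
    rcases hz with rfl | rfl
    · exact .inr (.inl ⟨m, by omega, h⟩)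
    · exact .inr (.inr ⟨m, by omega, h⟩)

lemma IsKGeodetic.length_unique {k : ℕ} (hgeo : IsKGeodetic A k) {m n : ℕ} {x y : V}
    (h : y ∈ NIter A m x) (h' : y ∈ NIter A n x) (hm : m ≤ k) (hn : n ≤ k) : m = n := by
  obtain ⟨p, hp, hpl⟩ := h
  obtain ⟨q, hq, hql⟩ := h'
  have := hgeo x y p q hp hq (by omega) (by omega)
  subst this
  omega

lemma IsKGeodetic.first_unique {k : ℕ} (hgeo : IsKGeodetic A k) {m n : ℕ} {x y a b : V}
    (ha : A x a) (hb : A x b) (h : y ∈ NIter A m a) (h' : y ∈ NIter A n b)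
    (hm : m < k) (hn : n < k) : a = b := by
  obtain ⟨p, hp, hpl⟩ := h
  obtain ⟨q, hq, hql⟩ := h'
  have h := hgeo x y _ _ (hp.cons ha) (hq.cons hb) (by simp; omega) (by simp; omega)
  obtain rfl : p = q := by simpa using h
  have := hp.2.1.symm.trans hq.2.1
  simpa using this

lemma IsKGeodetic.no_short_cycle {k : ℕ} (hgeo : IsKGeodetic A k) {m : ℕ} {x : V}
    (h : x ∈ NIter A m x) (hm : m ≤ k) : m = 0 :=
  hgeo.length_unique h (mem_nIter_zero.2 rfl) hm (Nat.zero_le k)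

lemma IsDiregular.exists_out (hreg : IsDiregular A 2) (x : V) :
    ∃ a b, a ≠ b ∧ Nout A x = {a, b} :=
  Set.ncard_eq_two.1 (hreg x).1

lemma ncard_nIter [Finite V] {k : ℕ} (hreg : IsDiregular A 2) (hgeo : IsKGeodetic A k) {n : ℕ}
    (hn : n ≤ k) (x : V) : (NIter A n x).ncard = 2 ^ n := by
  induction n generalizing x with
  | zero =>
    have : NIter A 0 x = {x} := by
      ext y
      simp [mem_nIter_zero, eq_comm]
    simp [this]
  | succ n ih =>
    obtain ⟨a, b, hab, hx⟩ := hreg.exists_out x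
    have ha : A x a := (Set.ext_iff.1 hx a).2 (by simp)
    have hb : A x b := (Set.ext_iff.1 hx b).2 (by simp)
    have hunion : NIter A (n + 1) x = NIter A n a ∪ NIter A n b := by
      ext y
      have hz : ∀ z, A x z ↔ z = a ∨ z = b := fun z => Set.ext_iff.1 hx z
      simp [mem_nIter_succ, hz, or_and_right, exists_or]
    rw [hunion, Set.ncard_union_eq, ih (by omega), ih (by omega)]
    · ring
    · rw [Set.disjoint_left]
      exact fun y h h' => hab (hgeo.first_unique ha hb h h' (by omega) (by omega))

lemma ncard_ball [Finite V] {k : ℕ} (hreg : IsDiregular A 2) (hgeo : IsKGeodetic A k) {n : ℕ}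
    (hn : n ≤ k) (x : V) : (Ball A n x).ncard = moore 2 n := by
  induction n with
  | zero =>
    have : Ball A 0 x = NIter A 0 x := by
      ext y
      simp [Ball]
    rw [this, ncard_nIter hreg hgeo hn]
    simp [moore]
  | succ n ih =>
    have hunion : Ball A (n + 1) x = Ball A n x ∪ NIter A (n + 1) x := by
      ext y
      simp only [Ball, Set.mem_ofPred_eq, Set.mem_union]
      constructor
      · rintro ⟨m, hm, h⟩
        rcases Nat.le_succ_iff.1 hm with hm | rfl
        · exact .inl ⟨m, hm, h⟩
        · exact .inr h
      · rintro (⟨m, hm, h⟩ | h)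
        · exact ⟨m, by omega, h⟩
        · exact ⟨n + 1, le_rfl, h⟩
    rw [hunion, Set.ncard_union_eq, ih (by omega), ncard_nIter hreg hgeo hn]
    · simp [moore, Finset.sum_range_succ]
    · rw [Set.disjoint_left]
      rintro y ⟨m, hm, h⟩ h'
      have := hgeo.length_unique h h' (by omega) hn
      omega

lemma ncard_outliers [Fintype V] {k e : ℕ} (hreg : IsDiregular A 2) (hgeo : IsKGeodetic A k)
    (hcard : Fintype.card V = moore 2 k + e) (x : V) : (Outliers A k x).ncard = e := by
  have h := Set.ncard_add_ncard_compl (Ball A k x)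
  rw [ncard_ball hreg hgeo le_rfl, Nat.card_eq_fintype_card, hcard] at h
  have hcompl : Outliers A k x = (Ball A k x)ᶜ := rfl
  rw [hcompl]
  omega

end Walks

section FixedPair

variable {V : Type*} {A : V → V → Prop} {k : ℕ} {u v u₁ u₂ v₁ : V}

lemma IsDiregular.ne_of_nout_eq (hreg : IsDiregular A 2) (hu : Nout A u = {u₁, u₂}) :
    u₁ ≠ u₂ := by
  rintro rfl
  have h := (hreg u).1
  simp [hu] at h

lemma adj_left_of_nout_eq (hu : Nout A u = {u₁, u₂}) : A u u₁ :=
  (Set.ext_iff.1 hu u₁).2 (by simp)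

lemma adj_right_of_nout_eq (hu : Nout A u = {u₁, u₂}) : A u u₂ :=
  (Set.ext_iff.1 hu u₂).2 (by simp)

/-- If `v₁` is not an outlier of `u`, then it lies within distance `k - 1` of `u₁`. -/
lemma exists_mem_nIter_of_mem_ball (hreg : IsDiregular A 2) (hgeo : IsKGeodetic A k)
    (hu : Nout A u = {u₁, u₂}) (hv : Nout A v = {v₁, u₂}) (hk : 3 ≤ k)
    (h : v₁ ∈ Ball A k u) : ∃ m < k, v₁ ∈ NIter A m u₁ := by
  have hvv₁ := adj_left_of_nout_eq hv
  have hvu₂ := adj_right_of_nout_eq hv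
  have hne := hreg.ne_of_nout_eq hv
  rcases eq_or_mem_nIter_of_mem_ball hu h with rfl | h | ⟨m, hm, h⟩
  · exact absurd (hgeo.first_unique hvv₁ hvu₂
      (mem_nIter_one.2 (adj_right_of_nout_eq hu)) (mem_nIter_zero.2 rfl)
      (by omega) (by omega)) hne
  · exact h
  · exact absurd (hgeo.first_unique hvv₁ hvu₂ (mem_nIter_zero.2 rfl) h (by omega) hm) hne

/-- A vertex `v₁ ≠ u₁` with short paths from and to `u₁` is at distance exactly `k - 1`
from `u₁`, and its out-neighbours are outliers of `u`. -/
lemma distance_eq_and_nout_subset [Fintype V] (hreg : IsDiregular A 2) (hgeo : IsKGeodetic A k)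
    (hcard : Fintype.card V = moore 2 k + 3)
    (hu : Nout A u = {u₁, u₂}) (hv : Nout A v = {v₁, u₂}) (huv : u₁ ≠ v₁)
    {m n : ℕ} (hm : m < k) (hn : n < k)
    (h : v₁ ∈ NIter A m u₁) (h' : u₁ ∈ NIter A n v₁) :
    m = k - 1 ∧ Nout A v₁ ⊆ Outliers A k u := by
  have hvv₁ := adj_left_of_nout_eq hv
  have hvu₂ := adj_right_of_nout_eq hv
  have hne := hreg.ne_of_nout_eq hv
  have hm0 : m ≠ 0 := by
    rintro rfl
    exact huv (mem_nIter_zero.1 h)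
  have hm1 : m ≠ 1 := by
    rintro rfl
    have := hgeo.no_short_cycle (mem_nIter_add h h') (by omega)
    omega
  have hsub : NIter A (k - m) v₁ ⊆ Outliers A k u := by
    intro z hz hball
    rcases eq_or_mem_nIter_of_mem_ball hu hball with rfl | ⟨j, hj, hz'⟩ | ⟨j, hj, hz'⟩
    · exact hne (hgeo.first_unique hvv₁ hvu₂
        (mem_nIter_add hz (mem_nIter_one.2 (adj_right_of_nout_eq hu)))
        (mem_nIter_zero.2 rfl) (by omega) (by omega))
    · have := hgeo.length_unique (mem_nIter_add h hz) hz' (by omega) (by omega)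
      omega
    · exact hne (hgeo.first_unique hvv₁ hvu₂ hz hz' (by omega) hj)
  have hle := Set.ncard_le_ncard hsub
  rw [ncard_nIter hreg hgeo (by omega), ncard_outliers hreg hgeo hcard] at hle
  have hmk : k - m < 2 := by
    by_contra! hlt
    have := Nat.pow_le_pow_right (n := 2) (by norm_num) hlt
    omega
  refine ⟨by omega, fun z hz => hsub ?_⟩
  rw [show k - m = 1 by omega]
  exact mem_nIter_one.2 hz

lemma mem_outliers_of_mem_nIter (hreg : IsDiregular A 2) (hgeo : IsKGeodetic A k)
    (hu : Nout A u = {u₁, u₂}) (hv : Nout A v = {v₁, u₂}) (huv : u₁ ≠ v₁) (hk : 3 ≤ k)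
    (h : u₁ ∈ NIter A (k - 1) v₁) : u ∈ Outliers A k v := by
  have huu₁ := adj_left_of_nout_eq hu
  have huu₂ := adj_right_of_nout_eq hu
  intro hball
  rcases eq_or_mem_nIter_of_mem_ball hv hball with rfl | ⟨j, hj, hz⟩ | ⟨j, hj, hz⟩
  · have hmem : u₁ ∈ Nout A u := huu₁
    rw [hv] at hmem
    rcases hmem with hmem | hmem
    · exact huv hmem
    · exact hreg.ne_of_nout_eq hu hmem
  · have := hgeo.length_unique (mem_nIter_add hz (mem_nIter_one.2 huu₁)) h (by omega) (by omega)
    exact hreg.ne_of_nout_eq hv (hgeo.first_unique (adj_left_of_nout_eq hv)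
      (adj_right_of_nout_eq hv) (mem_nIter_add hz (mem_nIter_one.2 huu₂))
      (mem_nIter_zero.2 rfl) (by omega) (by omega))
  · have := hgeo.no_short_cycle (mem_nIter_succ.2 ⟨u₂, huu₂, hz⟩) (by omega)
    omega

/-- If `u` and the out-neighbours of its out-neighbour `u₁` are outliers of `v`, then `v` has
no other outliers. -/
lemma eq_or_adj_of_mem_outliers [Fintype V] (hreg : IsDiregular A 2) (hgeo : IsKGeodetic A k)
    (hcard : Fintype.card V = moore 2 k + 3) (hk : 3 ≤ k) (huu₁ : A u u₁)
    (hmem : u ∈ Outliers A k v) (hsub : Nout A u₁ ⊆ Outliers A k v) {z : V}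
    (hz : z ∈ Outliers A k v) : z = u ∨ A u₁ z := by
  have hnot : u ∉ Nout A u₁ := by
    intro h
    have := hgeo.no_short_cycle (mem_nIter_succ.2 ⟨u₁, huu₁, mem_nIter_one.2 h⟩) (by omega)
    omega
  have heq : insert u (Nout A u₁) = Outliers A k v := by
    apply Set.eq_of_subset_of_ncard_le (Set.insert_subset hmem hsub)
    rw [ncard_outliers hreg hgeo hcard, Set.ncard_insert_of_notMem hnot, (hreg u₁).1]
  rw [← heq] at hz
  exact hz

lemma false_of_distance_eq [Fintype V] (hreg : IsDiregular A 2) (hgeo : IsKGeodetic A k)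
    (hcard : Fintype.card V = moore 2 k + 3)
    (hu : Nout A u = {u₁, u₂}) (hv : Nout A v = {v₁, u₂}) (huv : u₁ ≠ v₁) (hk : 3 ≤ k)
    (h : v₁ ∈ NIter A (k - 1) u₁) (h' : u₁ ∈ NIter A (k - 1) v₁)
    (hsubu : Nout A v₁ ⊆ Outliers A k u) (hsubv : Nout A u₁ ⊆ Outliers A k v) : False := by
  have huu₁ := adj_left_of_nout_eq hu
  have huu₂ := adj_right_of_nout_eq hu
  have hvv₁ := adj_left_of_nout_eq hv
  have hneu := hreg.ne_of_nout_eq hu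
  have hu_out := mem_outliers_of_mem_nIter hreg hgeo hu hv huv hk h'
  have hv_out := mem_outliers_of_mem_nIter hreg hgeo hv hu huv.symm hk h
  have key : ∀ {j : ℕ} {z : V}, 2 ≤ j → j < k → z ∈ NIter A j u₁ →
      ∃ l < k, z ∈ NIter A l v₁ := by
    intro j z hj hjk hz
    by_cases hball : z ∈ Ball A k v
    · rcases eq_or_mem_nIter_of_mem_ball hv hball with rfl | hl | ⟨l, hl, hz'⟩
      · exact absurd ⟨j + 1, by omega, mem_nIter_succ.2 ⟨u₁, huu₁, hz⟩⟩ hv_out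
      · exact hl
      · exact absurd (hgeo.first_unique huu₁ huu₂ hz hz' hjk hl) hneu
    · rcases eq_or_adj_of_mem_outliers hreg hgeo hcard hk huu₁ hu_out hsubv hball with rfl | hz'
      · have := hgeo.no_short_cycle (mem_nIter_succ.2 ⟨u₁, huu₁, hz⟩) (by omega)
        omega
      · have := hgeo.length_unique hz (mem_nIter_one.2 hz') (by omega) (by omega)
        omega
  rw [show k - 1 = (k - 3) + 1 + 1 by omega] at h
  obtain ⟨w, hw, h⟩ := mem_nIter_succ.1 h
  obtain ⟨a, ha, hav⟩ := mem_nIter_succ.1 h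
  obtain ⟨t, ht, hta⟩ : ∃ t, A w t ∧ a ≠ t := by
    obtain ⟨b, c, hbc, hN⟩ := hreg.exists_out w
    by_cases hab : a = b
    · exact ⟨c, adj_right_of_nout_eq hN, hab ▸ hbc⟩
    · exact ⟨b, adj_left_of_nout_eq hN, hab⟩
  have hut : t ∈ NIter A 2 u₁ := mem_nIter_succ.2 ⟨w, hw, mem_nIter_one.2 ht⟩
  obtain ⟨l, hl, hvt⟩ := key le_rfl (by omega) hut
  have hl0 : l ≠ 0 := by
    rintro rfl
    obtain rfl := mem_nIter_zero.1 hvt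
    exact hta (hgeo.first_unique ha ht hav (mem_nIter_zero.2 rfl) (by omega) (by omega))
  have hl1 : l ≠ 1 := by
    rintro rfl
    exact hsubu (mem_nIter_one.1 hvt) ⟨3, hk, mem_nIter_succ.2 ⟨u₁, huu₁, hut⟩⟩
  have hl2 : l ≠ 2 := by
    rintro rfl
    exact hta (hgeo.first_unique ha ht (mem_nIter_add hav hvt) (mem_nIter_zero.2 rfl)
      (by omega) (by omega))
  obtain ⟨z, hz⟩ : (NIter A (k - l) t).Nonempty := by
    apply Set.nonempty_of_ncard_ne_zero
    rw [ncard_nIter hreg hgeo (by omega)]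
    positivity
  obtain ⟨i, hi, hvz⟩ := key (by omega) (by omega) (mem_nIter_add hut hz)
  have := hgeo.length_unique hvz (mem_nIter_add hvt hz) (by omega) (by omega)
  omega

end FixedPair

/-- Fixed-pair setup, `k ≥ 3`: either `v₁ ∈ O(u)` or `u₁ ∈ O(v)`. -/
theorem v1_outlier_or_u1_outlier {V : Type*} [Fintype V] (A : V → V → Prop) (k : ℕ)
    (u v u₁ u₂ v₁ : V)
    (hirr : Irreflexive A) (hreg : IsDiregular A 2) (hgeo : IsKGeodetic A k)
    (hcard : Fintype.card V = moore 2 k + 3)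
    (hu : Nout A u = {u₁, u₂}) (hv : Nout A v = {v₁, u₂}) (huv : u₁ ≠ v₁)
    (hk : 3 ≤ k) :
    v₁ ∈ Outliers A k u ∨ u₁ ∈ Outliers A k v := by
  by_contra hcon
  simp only [Outliers, Set.mem_ofPred_eq, not_or, not_not] at hcon
  obtain ⟨m, hm, h⟩ := exists_mem_nIter_of_mem_ball hreg hgeo hu hv hk hcon.1
  obtain ⟨n, hn, h'⟩ := exists_mem_nIter_of_mem_ball hreg hgeo hv hu hk hcon.2
  obtain ⟨rfl, hsubu⟩ := distance_eq_and_nout_subset hreg hgeo hcard hu hv huv hm hn h h'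
  obtain ⟨rfl, hsubv⟩ := distance_eq_and_nout_subset hreg hgeo hcard hv hu huv.symm hn hm h' h
  exact false_of_distance_eq hreg hgeo hcard hu hv huv hk h h' hsubu hsubv
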